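/- arXiv:2011.14617 — 11 statements merged into one kernel-verified Lean document; each statement's English description precedes it below -/
import Mathlib

section
/- Let h : S → ℝ≥0∞ be defined by h x = ⨆ n, hit n x. Then h is a fixed point of the probabilistic transfer operator Φ (i.e., Φ h = h pointwise), and for every function f : S → ℝ≥0∞ that is a pre fixed-point of Φ (i.e., Φ f ≤ f pointwise), one has h ≤ f pointwise. Consequently, h is the least fixed point of Φ on the complete lattice of functions S → ℝ≥0∞ ordered pointwise. -/
open scoped ENNReal Classical

/-- The supremum of the n-step violation probabilities is the least fixed point of the
probabilistic transfer operator `Φ`. -/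
theorem stmt_0 {S : Type*} (step : S → PMF S) (F G : Set S) (hFG : Disjoint F G)
    (hit : ℕ → S → ℝ≥0∞)
    (hhit0 : ∀ x, hit 0 x = if x ∈ F then 1 else 0)
    (hhitS : ∀ n x, hit (n + 1) x =
      if x ∈ F then 1 else if x ∈ G then 0 else ∑' y, step x y * hit n y)
    (Φ : (S → ℝ≥0∞) → (S → ℝ≥0∞))
    (hΦ : ∀ f x, Φ f x =
      if x ∈ F then 1 else if x ∈ G then 0 else ∑' y, step x y * f y)
    (h : S → ℝ≥0∞) (hh : ∀ x, h x = ⨆ n, hit n x) :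
    (∀ x, Φ h x = h x) ∧
    (∀ f : S → ℝ≥0∞, (∀ x, Φ f x ≤ f x) → ∀ x, h x ≤ f x) ∧
    IsLeast {f : S → ℝ≥0∞ | Φ f = f} h := by
  have hS : ∀ n x, hit (n + 1) x = Φ (hit n) x := fun n x => by rw [hhitS, hΦ]
  have mono : ∀ f g : S → ℝ≥0∞, f ≤ g → Φ f ≤ Φ g := by
    intro f g hfg x
    rw [hΦ, hΦ]
    split_ifs
    · exact le_rfl
    · exact le_rfl
    · exact ENNReal.tsum_le_tsum fun y => mul_le_mul_right (hfg y) _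
  have hmono : Monotone hit := by
    apply monotone_nat_of_le_succ
    intro n
    induction n with
    | zero =>
      intro x
      rw [hhit0, hhitS]
      split_ifs <;> simp
    | succ k ih =>
      intro x
      rw [hS, hS]
      exact mono _ _ ih x
  have least : ∀ f : S → ℝ≥0∞, (∀ x, Φ f x ≤ f x) → ∀ x, h x ≤ f x := by
    intro f hf x
    rw [hh]
    refine iSup_le fun n => ?_
    have key : ∀ n, hit n ≤ f := by
      intro n
      induction n with
      | zero =>
        intro x
        refine le_trans ?_ (hf x)
        rw [hhit0, hΦ]
        split_ifs <;> simp
      | succ k ih =>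
        intro x
        rw [hS]
        exact (mono _ _ ih x).trans (hf x)
    exact key n x
  have fixed : ∀ x, Φ h x = h x := by
    intro x
    have e : h x = ⨆ n, hit (n + 1) x := by
      rw [hh]
      exact ((show Monotone fun n => hit n x from
        fun a b hab => hmono hab x).iSup_nat_add 1).symm
    rw [e, hΦ]
    simp only [hhitS]
    split_ifs
    · simp
    · simp
    · simp only [hh, ENNReal.mul_iSup]
      rw [ENNReal.tsum_eq_iSup_sum]
      simp only [ENNReal.tsum_eq_iSup_sum]
      rw [iSup_comm]
      refine iSup_congr fun s => ?_
      exact ENNReal.finsetSum_iSup_of_monotone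
        fun y a b hab => mul_le_mul_right (hmono hab y) _
  exact ⟨fixed, least, funext fixed, fun f hf x => least f (fun y => (congrFun hf y).le) x⟩
end

section
/- Suppose f : S → ℝ≥0∞ satisfies: (i) f x ≥ 1 for every x ∈ F, and (ii) for every x ∉ F ∪ G, ∑' y, step x y * f y ≤ f x. Then for every n ∈ ℕ and every state x ∈ S, hit n x ≤ f x. (Every pre fixed-point is an upper bound on the n-step violation probability, for every n.) -/
open scoped ENNReal Classical

/-- Every pre fixed-point of the probabilistic transfer operator is an upper bound on the
n-step violation probability, for every `n`. -/
theorem stmt_1 {S : Type*} (step : S → PMF S) (F G : Set S) (hFG : Disjoint F G)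
    (hit : ℕ → S → ℝ≥0∞)
    (hhit0 : ∀ x, hit 0 x = if x ∈ F then 1 else 0)
    (hhitS : ∀ n x, hit (n + 1) x =
      if x ∈ F then 1 else if x ∈ G then 0 else ∑' y, step x y * hit n y)
    (f : S → ℝ≥0∞)
    (hF : ∀ x ∈ F, 1 ≤ f x)
    (hpre : ∀ x, x ∉ F ∪ G → (∑' y, step x y * f y) ≤ f x) :
    ∀ (n : ℕ) (x : S), hit n x ≤ f x := by
  intro n
  induction n with
  | zero =>
    intro x
    rw [hhit0]
    split_ifs with h
    · exact hF x h
    · exact zero_le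
  | succ n ih =>
    intro x
    rw [hhitS]
    split_ifs with h h'
    · exact hF x h
    · exact zero_le
    · refine le_trans (ENNReal.tsum_le_tsum fun y => ?_) (hpre x (fun hx => hx.elim h h'))
      exact mul_le_mul_right (ih y) _
end

section
/- Let M ∈ ℝ≥0∞ with M < ∞, and let f : S → ℝ≥0∞ satisfy: (i) f x ≤ M for all x ∈ S; (ii) f x ≤ 1 for every x ∈ F; (iii) f x = 0 for every x ∈ G; and (iv) for every x ∉ F ∪ G, f x ≤ ∑' y, step x y * f y (f is a post fixed-point). Then for every n ∈ ℕ and every x ∈ S, f x ≤ hit n x + M * alive n x. -/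
open scoped ENNReal Classical

/-- A bounded post fixed-point is bounded by the n-step violation probability plus `M` times
the n-step survival probability. -/
theorem stmt_2 {S : Type*} (step : S → PMF S) (F G : Set S) (hFG : Disjoint F G)
    (hit : ℕ → S → ℝ≥0∞)
    (hhit0 : ∀ x, hit 0 x = if x ∈ F then 1 else 0)
    (hhitS : ∀ n x, hit (n + 1) x =
      if x ∈ F then 1 else if x ∈ G then 0 else ∑' y, step x y * hit n y)
    (alive : ℕ → S → ℝ≥0∞)
    (halive0 : ∀ x, alive 0 x = if x ∉ F ∪ G then 1 else 0)
    (haliveS : ∀ n x, alive (n + 1) x =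
      if x ∈ F ∪ G then 0 else ∑' y, step x y * alive n y)
    (M : ℝ≥0∞) (hM : M < ∞) (f : S → ℝ≥0∞)
    (hbdd : ∀ x, f x ≤ M)
    (hF : ∀ x ∈ F, f x ≤ 1)
    (hG : ∀ x ∈ G, f x = 0)
    (hpost : ∀ x, x ∉ F ∪ G → f x ≤ ∑' y, step x y * f y) :
    ∀ (n : ℕ) (x : S), f x ≤ hit n x + M * alive n x := by
  intro n
  induction n with
  | zero =>
    intro x
    by_cases h1 : x ∈ F
    · rw [hhit0, if_pos h1]
      exact (hF x h1).trans le_self_add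
    · by_cases h2 : x ∈ G
      · rw [hG x h2]
        exact zero_le
      · have h3 : x ∉ F ∪ G := fun h => h.elim h1 h2
        rw [halive0, if_pos h3, mul_one]
        exact (hbdd x).trans le_add_self
  | succ n ih =>
    intro x
    by_cases h1 : x ∈ F
    · rw [hhitS, if_pos h1]
      exact (hF x h1).trans le_self_add
    · by_cases h2 : x ∈ G
      · rw [hG x h2]
        exact zero_le
      · have h3 : x ∉ F ∪ G := fun h => h.elim h1 h2
        rw [hhitS, haliveS, if_neg h1, if_neg h2, if_neg h3, ← ENNReal.tsum_mul_left,
          ← ENNReal.tsum_add]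
        refine (hpost x h3).trans (ENNReal.tsum_le_tsum fun y => ?_)
        calc step x y * f y ≤ step x y * (hit n y + M * alive n y) := by
              gcongr
              exact ih y
          _ = step x y * hit n y + M * (step x y * alive n y) := by ring
end

section
/- Assume the chain terminates almost surely from every state, i.e., ⨅ n, alive n x = 0 for every x ∈ S. Let M ∈ ℝ≥0∞ with M < ∞ and let f : S → ℝ≥0∞ satisfy: (i) f x ≤ M for all x; (ii) f x ≤ 1 for every x ∈ F; (iii) f x = 0 for every x ∈ G; and (iv) for every x ∉ F ∪ G, f x ≤ ∑' y, step x y * f y (f is a bounded post fixed-point). Then for every x ∈ S, f x ≤ ⨆ n, hit n x. (Every bounded post fixed-point is a lower bound on the violation probability under almost-sure termination.) -/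
open scoped ENNReal Classical

/-- Under almost-sure termination, every bounded post fixed-point is a lower bound on the
violation probability. -/
theorem stmt_3 {S : Type*} (step : S → PMF S) (F G : Set S) (hFG : Disjoint F G)
    (hit : ℕ → S → ℝ≥0∞)
    (hhit0 : ∀ x, hit 0 x = if x ∈ F then 1 else 0)
    (hhitS : ∀ n x, hit (n + 1) x =
      if x ∈ F then 1 else if x ∈ G then 0 else ∑' y, step x y * hit n y)
    (alive : ℕ → S → ℝ≥0∞)
    (halive0 : ∀ x, alive 0 x = if x ∉ F ∪ G then 1 else 0)
    (haliveS : ∀ n x, alive (n + 1) x =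
      if x ∈ F ∪ G then 0 else ∑' y, step x y * alive n y)
    (hAST : ∀ x : S, (⨅ n, alive n x) = 0)
    (M : ℝ≥0∞) (hM : M < ∞) (f : S → ℝ≥0∞)
    (hbdd : ∀ x, f x ≤ M)
    (hF : ∀ x ∈ F, f x ≤ 1)
    (hG : ∀ x ∈ G, f x = 0)
    (hpost : ∀ x, x ∉ F ∪ G → f x ≤ ∑' y, step x y * f y) :
    ∀ x : S, f x ≤ ⨆ n, hit n x := by
  have key : ∀ n x, f x ≤ hit n x + M * alive n x := by
    intro n
    induction n with
    | zero =>
      intro x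
      rw [hhit0, halive0]
      by_cases h1 : x ∈ F
      · simp [h1, hF x h1]
      · by_cases h2 : x ∈ G
        · simp [hG x h2]
        · simp [h1, h2, hbdd x]
    | succ n ih =>
      intro x
      rw [hhitS, haliveS]
      by_cases h1 : x ∈ F
      · simp [h1, hF x h1]
      · by_cases h2 : x ∈ G
        · simp [hG x h2]
        · have h3 : x ∉ F ∪ G := by simp [h1, h2]
          rw [if_neg h1, if_neg h2, if_neg h3, ← ENNReal.tsum_mul_left, ← ENNReal.tsum_add]
          refine (hpost x h3).trans (ENNReal.tsum_le_tsum fun y => ?_)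
          calc step x y * f y ≤ step x y * (hit n y + M * alive n y) := by
                gcongr; exact ih y
            _ = _ := by ring
  intro x
  have h : f x ≤ ⨅ n, ((⨆ n, hit n x) + M * alive n x) :=
    le_iInf fun n => (key n x).trans (by gcongr; exact le_iSup (fun n => hit n x) n)
  rw [← ENNReal.add_iInf, ← ENNReal.mul_iInf (fun h => absurd h hM.ne), hAST] at h
  simpa using h
end

section
/- Let (Ω, μ) be a probability space, k ∈ ℕ, and p : Fin k → ℝ with p j ≥ 0 for all j and ∑ j, p j = 1. Let β ∈ ℝ, Δ > 0, ε ≥ 0, and for each j ∈ Fin k let D j : Ω → ℝ be a measurable random variable such that β ≤ D j ω ≤ β + Δ for μ-almost every ω, and ∫ ω, D j ω ∂μ ≤ -ε. Then ∑ j, p j * ∫ ω, Real.exp ((8 * ε / Δ^2) * D j ω) ∂μ ≤ 1. -/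
open MeasureTheory

/-- Key Hoeffding-lemma step in the derivation of exponential pre fixed-points from
`(β, Δ, ε)`-repulsing ranking supermartingales. -/
theorem stmt_4 {Ω : Type*} [MeasurableSpace Ω] (μ : Measure Ω) [IsProbabilityMeasure μ]
    (k : ℕ) (p : Fin k → ℝ) (hp : ∀ j, 0 ≤ p j) (hpsum : ∑ j, p j = 1)
    (β Δ ε : ℝ) (hΔ : 0 < Δ) (hε : 0 ≤ ε)
    (D : Fin k → Ω → ℝ) (hmeas : ∀ j, Measurable (D j))
    (hbound : ∀ j, ∀ᵐ ω ∂μ, β ≤ D j ω ∧ D j ω ≤ β + Δ)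
    (hdrift : ∀ j, (∫ ω, D j ω ∂μ) ≤ -ε) :
    ∑ j, p j * ∫ ω, Real.exp ((8 * ε / Δ ^ 2) * D j ω) ∂μ ≤ 1 := by
  have key : ∀ j, ∫ ω, Real.exp ((8 * ε / Δ ^ 2) * D j ω) ∂μ ≤ 1 := by
    intro j
    have h := (ProbabilityTheory.hasSubgaussianMGF_of_mem_Icc (μ := μ) (X := D j) (a := β)
      (b := β + Δ) (hmeas j).aemeasurable (hbound j)).mgf_le (8 * ε / Δ ^ 2)
    set t := 8 * ε / Δ ^ 2 with ht
    have ht0 : 0 ≤ t := by positivity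
    have htΔ : t * Δ ^ 2 = 8 * ε := by rw [ht]; field_simp
    have hm := hdrift j
    set m := ∫ ω, D j ω ∂μ with hmdef
    have e : ∀ ω, Real.exp (t * D j ω) = Real.exp (t * m) * Real.exp (t * (D j ω - m)) := by
      intro ω
      rw [← Real.exp_add]
      congr 1
      ring
    simp_rw [e]
    rw [integral_const_mul]
    have hc : (((‖β + Δ - β‖₊ / 2) ^ 2 : NNReal) : ℝ) = Δ ^ 2 / 4 := by
      push_cast
      rw [add_sub_cancel_left, Real.norm_eq_abs, div_pow, sq_abs]
      norm_num
    rw [hc] at h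
    refine (mul_le_mul_of_nonneg_left h (Real.exp_pos _).le).trans ?_
    rw [← Real.exp_add, Real.exp_le_one_iff]
    have h1 : Δ ^ 2 / 4 * t ^ 2 / 2 = t * ε := by
      have : Δ ^ 2 / 4 * t ^ 2 / 2 = t * (t * Δ ^ 2) / 8 := by ring
      rw [this, htΔ]
      ring
    rw [h1]
    nlinarith [mul_le_mul_of_nonneg_left hm ht0]
  calc ∑ j, p j * ∫ ω, Real.exp ((8 * ε / Δ ^ 2) * D j ω) ∂μ
      ≤ ∑ j, p j := Finset.sum_le_sum fun j _ => mul_le_of_le_one_right (hp j) (key j)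
    _ = 1 := hpsum
end

section
/- Let β ∈ ℝ, Δ > 0, ε ≥ 0, and let η : S → ℝ satisfy: (i) η x ≥ 0 for every x ∈ F; (ii) for every x ∉ F ∪ G and every y in the support of step x (i.e., step x y ≠ 0), β ≤ η y - η x ≤ β + Δ; and (iii) for every x ∉ F ∪ G, ∫ y, η y ∂((step x).toMeasure) ≤ η x - ε. Then for every n ∈ ℕ and every x ∈ S, hit n x ≤ ENNReal.ofReal (Real.exp ((8 * ε / Δ^2) * η x)). (A repulsing ranking supermartingale η yields the exponential pre fixed-point exp((8ε/Δ²)·η), which upper-bounds the violation probability.) -/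
open scoped ENNReal Classical
open MeasureTheory

theorem pmf_ae {S : Type*} [m : MeasurableSpace S] (hm : m = ⊤) (p : PMF S) (P : S → Prop)
    (h : ∀ y, p y ≠ 0 → P y) : ∀ᵐ y ∂p.toMeasure, P y := by
  haveI : DiscreteMeasurableSpace S := ⟨fun s => by subst hm; trivial⟩
  rw [ae_iff, PMF.toMeasure_apply_eq_zero_iff _ (MeasurableSet.of_discrete), Set.disjoint_left]
  intro y hy hn
  exact hn (h y hy)

theorem pmf_aux {S : Type*} [m : MeasurableSpace S] (hm : m = ⊤) (p : PMF S) (f : S → ℝ)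
    (hf : ∀ y, 0 ≤ f y) (hi : Integrable f p.toMeasure) :
    ∑' y, p y * ENNReal.ofReal (f y) = ENNReal.ofReal (∫ y, f y ∂p.toMeasure) := by
  haveI : DiscreteMeasurableSpace S := ⟨fun s => by subst hm; trivial⟩
  rw [ofReal_integral_eq_lintegral_ofReal hi (Filter.Eventually.of_forall hf),
    ← PMF.restrict_toMeasure_support p, lintegral_countable _ p.support_countable]
  have : ∀ a : p.support, ENNReal.ofReal (f a) * p.toMeasure {(a : S)}
      = (fun y => p y * ENNReal.ofReal (f y)) a := by
    intro a
    rw [PMF.toMeasure_apply_singleton _ _ (MeasurableSet.of_discrete), mul_comm]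
  rw [tsum_congr this]
  refine (tsum_subtype_eq_of_support_subset ?_).symm
  intro y hy h0
  exact hy (by simp [h0])

/-- A `(β, Δ, ε)`-repulsing ranking supermartingale `η` yields the exponential pre
fixed-point `exp((8ε/Δ²)·η)`, which upper-bounds the n-step violation probability. -/
theorem stmt_5 {S : Type*} [m : MeasurableSpace S] (hm : m = ⊤)
    (step : S → PMF S) (F G : Set S) (hFG : Disjoint F G)
    (hit : ℕ → S → ℝ≥0∞)
    (hhit0 : ∀ x, hit 0 x = if x ∈ F then 1 else 0)
    (hhitS : ∀ n x, hit (n + 1) x =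
      if x ∈ F then 1 else if x ∈ G then 0 else ∑' y, step x y * hit n y)
    (β Δ ε : ℝ) (hΔ : 0 < Δ) (hε : 0 ≤ ε)
    (η : S → ℝ)
    (hF : ∀ x ∈ F, 0 ≤ η x)
    (hdiff : ∀ x, x ∉ F ∪ G → ∀ y, step x y ≠ 0 →
      β ≤ η y - η x ∧ η y - η x ≤ β + Δ)
    (hdrift : ∀ x, x ∉ F ∪ G →
      (∫ y, η y ∂((step x).toMeasure)) ≤ η x - ε) :
    ∀ (n : ℕ) (x : S), hit n x ≤ ENNReal.ofReal (Real.exp ((8 * ε / Δ ^ 2) * η x)) := by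
  set t : ℝ := 8 * ε / Δ ^ 2 with ht
  have ht0 : 0 ≤ t := by positivity
  have hFb : ∀ x ∈ F, (1 : ℝ≥0∞) ≤ ENNReal.ofReal (Real.exp (t * η x)) := by
    intro x hx
    rw [ENNReal.one_le_ofReal]
    exact Real.one_le_exp (mul_nonneg ht0 (hF x hx))
  intro n
  induction n with
  | zero =>
    intro x
    rw [hhit0]
    split_ifs with h
    · exact hFb x h
    · exact zero_le
  | succ n ih =>
    intro x
    rw [hhitS]
    split_ifs with h h'
    · exact hFb x h
    · exact zero_le
    have hx : x ∉ F ∪ G := by simp [h, h']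
    calc ∑' y, step x y * hit n y
        ≤ ∑' y, step x y * ENNReal.ofReal (Real.exp (t * η y)) :=
          ENNReal.tsum_le_tsum fun y => by gcongr; exact ih y
      _ = ENNReal.ofReal (∫ y, Real.exp (t * η y) ∂(step x).toMeasure) :=
          pmf_aux hm _ _ (fun y => (Real.exp_pos _).le)
            (ProbabilityTheory.integrable_exp_mul_of_mem_Icc (a := η x + β) (b := η x + β + Δ)
              (by subst hm; exact measurable_from_top.aemeasurable)
              (pmf_ae hm _ _ fun y hy => by
                have := hdiff x hx y hy
                constructor <;> linarith))
      _ ≤ _ := ENNReal.ofReal_le_ofReal ?_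
    have hsub := ProbabilityTheory.hasSubgaussianMGF_of_mem_Icc (X := η) (μ := (step x).toMeasure)
      (a := η x + β) (b := η x + β + Δ)
              (by subst hm; exact measurable_from_top.aemeasurable)
              (pmf_ae hm _ _ fun y hy => by
                have := hdiff x hx y hy
                constructor <;> linarith)
    have h1 := hsub.mgf_le t
    have hd := hdrift x hx
    set M := ∫ y, η y ∂(step x).toMeasure
    have h2 : ∫ y, Real.exp (t * η y) ∂(step x).toMeasure
        = Real.exp (t * M) * ProbabilityTheory.mgf (fun y => η y - M) (step x).toMeasure t := by
      rw [ProbabilityTheory.mgf, ← integral_const_mul]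
      congr 1
      ext y
      rw [← Real.exp_add]
      ring_nf
    rw [h2]
    refine (mul_le_mul_of_nonneg_left h1 (Real.exp_pos _).le).trans ?_
    rw [← Real.exp_add, Real.exp_le_exp]
    have h3 : ((((‖η x + β + Δ - (η x + β)‖₊ / 2) ^ 2 : NNReal)) : ℝ) * t ^ 2 / 2 = t * ε := by
      have : η x + β + Δ - (η x + β) = Δ := by ring
      rw [this]
      push_cast
      rw [Real.norm_of_nonneg hΔ.le, ht]
      field_simp
      ring
    rw [h3]
    nlinarith [mul_le_mul_of_nonneg_left hd ht0]
end

section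
/- Let A be an m × n real matrix and d ∈ ℝ^m, and set Ψ = {v ∈ ℝⁿ | A·v ≤ d componentwise} and C = {v ∈ ℝⁿ | A·v ≤ 0 componentwise}. Let G ⊆ ℝⁿ be a nonempty finite set such that Ψ equals the Minkowski sum (convexHull ℝ G) + C. Let k ∈ ℕ and for each j ∈ Fin k let p j > 0, c j > 0, α j ∈ ℝⁿ, and β j ∈ ℝ. Then the universally quantified constraint (∀ v ∈ Ψ, ∑ j, p j * c j * Real.exp (⟪α j, v⟫ + β j) ≤ 1) holds if and only if both: (D1) for every j ∈ Fin k and every v ∈ C, ⟪α j, v⟫ ≤ 0; and (D2) for every generator g ∈ G, ∑ j, p j * c j * Real.exp (⟪α j, g⟫ + β j) ≤ 1. -/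
open scoped Matrix Pointwise

/-- Quantifier elimination for a canonical exponential constraint via Minkowski
decomposition: the universally quantified constraint over the polyhedron `Ψ = Q + C`
holds iff (D1) each exponent direction `α j` is nonpositive on the cone `C`, and
(D2) the constraint holds at each generator of the polytope `Q`. -/
theorem stmt_6 {m n : ℕ} (A : Matrix (Fin m) (Fin n) ℝ) (d : Fin m → ℝ)
    (Ψ C : Set (Fin n → ℝ))
    (hΨ : Ψ = {v | ∀ i, A.mulVec v i ≤ d i})
    (hC : C = {v | ∀ i, A.mulVec v i ≤ 0})
    (G : Finset (Fin n → ℝ)) (hG : G.Nonempty)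
    (hdecomp : Ψ = convexHull ℝ (↑G : Set (Fin n → ℝ)) + C)
    (k : ℕ) (p c : Fin k → ℝ) (hp : ∀ j, 0 < p j) (hc : ∀ j, 0 < c j)
    (α : Fin k → (Fin n → ℝ)) (β : Fin k → ℝ) :
    (∀ v ∈ Ψ, ∑ j, p j * c j * Real.exp (α j ⬝ᵥ v + β j) ≤ 1) ↔
      ((∀ j, ∀ v ∈ C, α j ⬝ᵥ v ≤ 0) ∧
        (∀ g ∈ G, ∑ j, p j * c j * Real.exp (α j ⬝ᵥ g + β j) ≤ 1)) := by
  have hq : ∀ j, 0 < p j * c j := fun j => mul_pos (hp j) (hc j)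
  have hmem : ∀ g ∈ convexHull ℝ (↑G : Set (Fin n → ℝ)), ∀ v ∈ C, g + v ∈ Ψ := by
    intro g hg v hv
    rw [hdecomp]
    exact Set.add_mem_add hg hv
  constructor
  · intro h
    refine ⟨?_, ?_⟩
    · intro j v hv
      by_contra! ha
      obtain ⟨g, hg⟩ := hG
      set a := α j ⬝ᵥ v with ha_def
      set q := p j * c j with hq_def
      have hqj : 0 < q := hq j
      set b := α j ⬝ᵥ g + β j with hb_def
      set t := (|b| + 1 / q) / a with ht_def
      have ht : 0 ≤ t := by positivity
      have hta : t * a = |b| + 1 / q := by rw [ht_def]; field_simp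
      have htv : t • v ∈ C := by
        rw [hC] at hv ⊢
        intro i
        have := hv i
        rw [Matrix.mulVec_smul, Pi.smul_apply, smul_eq_mul]
        exact mul_nonpos_of_nonneg_of_nonpos ht this
      have h1 := h _ (hmem g (subset_convexHull ℝ _ hg) _ htv)
      have h2 := Finset.single_le_sum
        (f := fun j => p j * c j * Real.exp (α j ⬝ᵥ (g + t • v) + β j))
        (fun i _ => (mul_pos (hq i) (Real.exp_pos _)).le) (Finset.mem_univ j)
      have h3 : α j ⬝ᵥ (g + t • v) + β j = b + t * a := by
        rw [dotProduct_add, dotProduct_smul, smul_eq_mul]; ring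
      simp only [h3] at h2
      have h4 := Real.add_one_le_exp (b + t * a)
      have h5 : 1 / q + 1 ≤ Real.exp (b + t * a) := by
        have := neg_abs_le b
        linarith
      have h6 : q * (1 / q + 1) ≤ q * Real.exp (b + t * a) :=
        mul_le_mul_of_nonneg_left h5 hqj.le
      have h7 : q * (1 / q + 1) = 1 + q := by field_simp
      linarith
    · intro g hg
      have h0 : (0 : Fin n → ℝ) ∈ C := by
        rw [hC]; intro i; simp
      have := h _ (hmem g (subset_convexHull ℝ _ hg) 0 h0)
      simpa using this
  · rintro ⟨h1, h2⟩ w hw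
    rw [hdecomp] at hw
    obtain ⟨x, hx, v, hv, rfl⟩ := Set.mem_add.1 hw
    have hconv : Convex ℝ {x : Fin n → ℝ | ∑ j, p j * c j * Real.exp (α j ⬝ᵥ x + β j) ≤ 1} := by
      intro x hx y hy s t hs ht hst
      simp only [Set.mem_setOf_eq] at hx hy ⊢
      have key : ∑ j, p j * c j * Real.exp (α j ⬝ᵥ (s • x + t • y) + β j) ≤
          s * ∑ j, p j * c j * Real.exp (α j ⬝ᵥ x + β j) +
          t * ∑ j, p j * c j * Real.exp (α j ⬝ᵥ y + β j) := by
        rw [Finset.mul_sum, Finset.mul_sum, ← Finset.sum_add_distrib]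
        refine Finset.sum_le_sum fun j _ => ?_
        have e := convexOn_exp.2 (Set.mem_univ (α j ⬝ᵥ x + β j))
          (Set.mem_univ (α j ⬝ᵥ y + β j)) hs ht hst
        simp only [smul_eq_mul] at e
        have e2 : α j ⬝ᵥ (s • x + t • y) + β j =
            s * (α j ⬝ᵥ x + β j) + t * (α j ⬝ᵥ y + β j) := by
          rw [dotProduct_add, dotProduct_smul, dotProduct_smul, smul_eq_mul, smul_eq_mul]
          linear_combination (-β j) * hst
        rw [e2]
        have := mul_le_mul_of_nonneg_left e (hq j).le
        linarith
      have := mul_le_mul_of_nonneg_left hx hs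
      have := mul_le_mul_of_nonneg_left hy ht
      linarith
    have hx1 := convexHull_min (fun g hg => h2 g hg) hconv hx
    refine le_trans (Finset.sum_le_sum fun j _ => ?_) hx1
    refine mul_le_mul_of_nonneg_left (Real.exp_le_exp.2 ?_) (hq j).le
    have := h1 j v hv
    rw [dotProduct_add]
    linarith
end

section
/- Let d, n, m, k ∈ ℕ, let p : Fin k → ℝ with p j ≥ 0, fix v* ∈ ℝⁿ, and let μ be a probability measure on ℝ^m (with the Borel σ-algebra). For each j ∈ Fin k let α j : ℝ^d → ℝⁿ, β j : ℝ^d → ℝ, and γ j : ℝ^d → ℝ^m be affine maps. Assume that for every θ ∈ ℝ^d and every j, the function r ↦ Real.exp ⟪γ j θ, r⟫ is μ-integrable. Then the function F : ℝ^d → ℝ defined by F θ = ∑ j, p j * Real.exp (⟪α j θ, v*⟫ + β j θ) * ∫ r, Real.exp ⟪γ j θ, r⟫ ∂μ is convex on ℝ^d (ConvexOn ℝ Set.univ F). (The optimization problem Θ arising from the canonical constraints is a convex program.) -/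
open MeasureTheory
open scoped RealInnerProductSpace

/-- The objective/constraint function of the synthesis optimization problem `Θ`,
viewed as a function of the unknown template coefficients, is convex. -/
theorem stmt_7 (d n m k : ℕ) (p : Fin k → ℝ) (hp : ∀ j, 0 ≤ p j)
    (vstar : EuclideanSpace ℝ (Fin n))
    (μ : Measure (EuclideanSpace ℝ (Fin m))) [IsProbabilityMeasure μ]
    (α : Fin k → (EuclideanSpace ℝ (Fin d) →ᵃ[ℝ] EuclideanSpace ℝ (Fin n)))
    (β : Fin k → (EuclideanSpace ℝ (Fin d) →ᵃ[ℝ] ℝ))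
    (γ : Fin k → (EuclideanSpace ℝ (Fin d) →ᵃ[ℝ] EuclideanSpace ℝ (Fin m)))
    (hint : ∀ (θ : EuclideanSpace ℝ (Fin d)) (j : Fin k),
      Integrable (fun r => Real.exp ⟪γ j θ, r⟫) μ) :
    ConvexOn ℝ Set.univ (fun θ : EuclideanSpace ℝ (Fin d) =>
      ∑ j, p j * Real.exp (⟪α j θ, vstar⟫ + β j θ) *
        ∫ r, Real.exp ⟪γ j θ, r⟫ ∂μ) := by
  refine ⟨convex_univ, ?_⟩
  intro x _ y _ a b ha hb hab
  simp only [smul_eq_mul, Finset.mul_sum]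
  rw [← Finset.sum_add_distrib]
  refine Finset.sum_le_sum fun j _ => ?_
  have hα : α j (a • x + b • y) = a • α j x + b • α j y := Convex.combo_affine_apply hab
  have hβ : β j (a • x + b • y) = a • β j x + b • β j y := Convex.combo_affine_apply hab
  have hγ : γ j (a • x + b • y) = a • γ j x + b • γ j y := Convex.combo_affine_apply hab
  have hI := fun θ => (hint θ j).const_mul (Real.exp (⟪α j θ, vstar⟫ + β j θ))
  have key : Real.exp (⟪α j (a • x + b • y), vstar⟫ + β j (a • x + b • y)) *
        ∫ r, Real.exp ⟪γ j (a • x + b • y), r⟫ ∂μ ≤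
      a * (Real.exp (⟪α j x, vstar⟫ + β j x) * ∫ r, Real.exp ⟪γ j x, r⟫ ∂μ) +
      b * (Real.exp (⟪α j y, vstar⟫ + β j y) * ∫ r, Real.exp ⟪γ j y, r⟫ ∂μ) := by
    simp only [← integral_const_mul]
    rw [← integral_add ((hI x).const_mul a) ((hI y).const_mul b)]
    refine integral_mono (hI _) (((hI x).const_mul a).add ((hI y).const_mul b)) fun r => ?_
    simp only [Pi.add_apply, ← Real.exp_add]
    have h := convexOn_exp.2 (Set.mem_univ (⟪α j x, vstar⟫ + β j x + ⟪γ j x, r⟫))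
      (Set.mem_univ (⟪α j y, vstar⟫ + β j y + ⟪γ j y, r⟫)) ha hb hab
    simp only [smul_eq_mul] at h
    refine le_trans (le_of_eq ?_) h
    rw [hα, hβ, hγ]
    simp only [inner_add_left, real_inner_smul_left, smul_eq_mul]
    congr 1
    ring
  have := mul_le_mul_of_nonneg_left key (hp j)
  linarith
end

section
/- Let μ be a probability measure on ℝ^m, k ≥ 1, and for each j ∈ Fin k let p j > 0, α j ∈ ℝⁿ, β j ∈ ℝ, γ j ∈ ℝ^m; set Q = ∑ j, p j. Fix v ∈ ℝⁿ. Assume the identity map r ↦ r is μ-integrable with mean vector m̄ = ∫ r, r ∂μ, and that for each j the function r ↦ Real.exp ⟪γ j, r⟫ is μ-integrable. If Q⁻¹ * ∑ j, p j * (⟪α j, v⟫ + β j + ⟪γ j, m̄⟫) ≥ - Real.log Q, then ∑ j, p j * Real.exp (⟪α j, v⟫ + β j) * ∫ r, Real.exp ⟪γ j, r⟫ ∂μ ≥ 1. (Soundness of the Jensen-inequality strengthening of a lower-bound canonical constraint: the strengthened linear constraint implies the original exponential constraint.) -/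
open MeasureTheory
open scoped RealInnerProductSpace

/-- Soundness of the Jensen-inequality strengthening of a lower-bound canonical
constraint: the strengthened linear constraint implies the original exponential one. -/
theorem stmt_9 (n m k : ℕ) (hk : 1 ≤ k)
    (μ : Measure (EuclideanSpace ℝ (Fin m))) [IsProbabilityMeasure μ]
    (p : Fin k → ℝ) (hp : ∀ j, 0 < p j)
    (α : Fin k → EuclideanSpace ℝ (Fin n)) (β : Fin k → ℝ)
    (γ : Fin k → EuclideanSpace ℝ (Fin m))
    (Q : ℝ) (hQ : Q = ∑ j, p j)
    (v : EuclideanSpace ℝ (Fin n))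
    (hid : Integrable (fun r : EuclideanSpace ℝ (Fin m) => r) μ)
    (mbar : EuclideanSpace ℝ (Fin m)) (hmbar : mbar = ∫ r, r ∂μ)
    (hint : ∀ j, Integrable (fun r => Real.exp ⟪γ j, r⟫) μ)
    (hstrengthened :
      Q⁻¹ * ∑ j, p j * (⟪α j, v⟫ + β j + ⟪γ j, mbar⟫) ≥ - Real.log Q) :
    ∑ j, p j * Real.exp (⟪α j, v⟫ + β j) * ∫ r, Real.exp ⟪γ j, r⟫ ∂μ ≥ 1 := by
  have hne : (Finset.univ : Finset (Fin k)).Nonempty := ⟨⟨0, hk⟩, Finset.mem_univ _⟩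
  have hQpos : 0 < Q := by
    rw [hQ]; exact Finset.sum_pos (fun j _ => hp j) hne
  have h1 : ∀ j, Real.exp ⟪γ j, mbar⟫ ≤ ∫ r, Real.exp ⟪γ j, r⟫ ∂μ := by
    intro j
    have h := convexOn_exp.map_integral_le (μ := μ)
      (f := fun r : EuclideanSpace ℝ (Fin m) => ⟪γ j, r⟫)
      Real.continuous_exp.continuousOn isClosed_univ
      (Filter.Eventually.of_forall fun _ => Set.mem_univ _)
      (hid.const_inner (γ j)) (hint j)
    rwa [integral_inner hid (γ j), ← hmbar] at h
  have h2 := convexOn_exp.map_sum_le (t := Finset.univ) (w := fun j => Q⁻¹ * p j)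
    (p := fun j => ⟪α j, v⟫ + β j + ⟪γ j, mbar⟫)
    (fun j _ => mul_nonneg (inv_nonneg.2 hQpos.le) (hp j).le)
    (by rw [← Finset.mul_sum, ← hQ, inv_mul_cancel₀ hQpos.ne'])
    (fun _ _ => Set.mem_univ _)
  simp only [smul_eq_mul, mul_assoc, ← Finset.mul_sum] at h2
  have h3 : Q⁻¹ ≤ Real.exp (Q⁻¹ * ∑ j, p j * (⟪α j, v⟫ + β j + ⟪γ j, mbar⟫)) := by
    rw [← Real.exp_log (inv_pos.2 hQpos), Real.log_inv, Real.exp_le_exp,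
      Real.exp_neg, Real.exp_log hQpos]
    exact hstrengthened
  have h4 : 1 ≤ ∑ j, p j * Real.exp (⟪α j, v⟫ + β j + ⟪γ j, mbar⟫) := by
    have h5 := h3.trans h2
    have h6 := mul_le_mul_of_nonneg_left h5 hQpos.le
    rwa [mul_inv_cancel₀ hQpos.ne', mul_inv_cancel_left₀ hQpos.ne'] at h6
  refine ge_iff_le.2 (h4.trans (Finset.sum_le_sum fun j _ => ?_))
  rw [Real.exp_add _ ⟪γ j, mbar⟫, ← mul_assoc]
  exact mul_le_mul_of_nonneg_left (h1 j) (mul_nonneg (hp j).le (Real.exp_pos _).le)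
end

section
/- Suppose (ε₁, ω₁, λ₁) ∈ S and (ε₂, ω₂, λ₂) ∈ S are both local minima of g on S (a point x₀ ∈ S is a local minimum of g on S if there is δ > 0 with g x₀ ≤ g y for all y ∈ S with ‖y - x₀‖ < δ). Then ε₁ = ε₂ and ω₁ = ω₂. (The bilinear program arising from RepRSM synthesis has a unique local optimum in the (ε, ω) coordinates, provided a strictly interior feasible point exists.) -/
theorem aux_dir {k : ℕ} (S : Set (ℝ × ℝ × (Fin k → ℝ))) (hconv : Convex ℝ S)
    (x y : ℝ × ℝ × (Fin k → ℝ)) (hx : x ∈ S) (hy : y ∈ S)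
    (hloc : ∃ δ > 0, ∀ y ∈ S, ‖y - x‖ < δ → x.1 * x.2.1 ≤ y.1 * y.2.1) :
    0 ≤ x.1 * (y.2.1 - x.2.1) + x.2.1 * (y.1 - x.1) ∧
    (x.1 * (y.2.1 - x.2.1) + x.2.1 * (y.1 - x.1) = 0 →
      0 ≤ (y.1 - x.1) * (y.2.1 - x.2.1)) := by
  obtain ⟨δ, hδ, h⟩ := hloc
  set D := x.1 * (y.2.1 - x.2.1) + x.2.1 * (y.1 - x.1) with hD
  set Q := (y.1 - x.1) * (y.2.1 - x.2.1) with hQ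
  have hn : 0 < ‖y - x‖ + 1 := by positivity
  obtain ⟨s, hs0, hs1, hs⟩ : ∃ s : ℝ, 0 < s ∧ s ≤ 1 ∧ s * (‖y - x‖ + 1) ≤ δ := by
    refine ⟨min 1 (δ / (‖y - x‖ + 1)), by positivity, min_le_left _ _, ?_⟩
    rw [← le_div_iff₀ hn]
    exact min_le_right _ _
  have key : ∀ t : ℝ, 0 < t → t ≤ s → 0 ≤ D + t * Q := by
    intro t ht hts
    have hm : x + t • (y - x) ∈ S :=
      hconv.add_smul_sub_mem hx hy ⟨ht.le, hts.trans hs1⟩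
    have hh := h _ hm (by
      rw [add_sub_cancel_left, norm_smul, Real.norm_eq_abs, abs_of_pos ht]
      nlinarith [norm_nonneg (y - x)])
    simp only [Prod.fst_add, Prod.snd_add, Prod.smul_fst, Prod.smul_snd, Prod.fst_sub,
      Prod.snd_sub, smul_eq_mul] at hh
    have : 0 ≤ t * (D + t * Q) := by rw [hD, hQ]; nlinarith
    exact nonneg_of_mul_nonneg_right this ht
  refine ⟨?_, ?_⟩
  · by_contra! hneg
    have hq : 0 < |Q| + 1 := by positivity
    have hd : 0 < -D := by linarith
    have hpos : 0 < min s (-D / (|Q| + 1)) := by positivity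
    have h1 := key _ hpos (min_le_left _ _)
    have h2 := min_le_right s (-D / (|Q| + 1))
    rw [le_div_iff₀ hq] at h2
    nlinarith [le_abs_self Q]
  · intro h0
    have h1 := key s hs0 le_rfl
    rw [h0, zero_add] at h1
    exact nonneg_of_mul_nonneg_right h1 hs0

theorem aux_pos {k : ℕ} (S : Set (ℝ × ℝ × (Fin k → ℝ))) (hconv : Convex ℝ S)
    (hsign : ∀ p ∈ S, 0 ≤ p.1 ∧ p.2.1 ≤ 0)
    (hint : ∃ p ∈ S, 0 < p.1 ∧ p.2.1 < 0)
    (x : ℝ × ℝ × (Fin k → ℝ)) (hx : x ∈ S)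
    (hloc : ∃ δ > 0, ∀ y ∈ S, ‖y - x‖ < δ → x.1 * x.2.1 ≤ y.1 * y.2.1) :
    0 < x.1 ∧ x.2.1 < 0 := by
  obtain ⟨p, hp, hp1, hp2⟩ := hint
  obtain ⟨h1, h2⟩ := aux_dir S hconv x p hx hp hloc
  obtain ⟨ha, hb⟩ := hsign x hx
  rcases ha.eq_or_lt with ha | ha <;> rcases hb.eq_or_lt with hb | hb
  · rw [← ha, hb] at h2
    have := h2 (by ring)
    nlinarith
  · rw [← ha] at h1
    nlinarith
  · rw [hb] at h1
    nlinarith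
  · exact ⟨ha, hb⟩

/-- The bilinear program arising from RepRSM synthesis has a unique local optimum in the
`(ε, ω)` coordinates, provided a strictly interior feasible point exists. -/
theorem stmt_10 {k : ℕ} (S : Set (ℝ × ℝ × (Fin k → ℝ))) (hconv : Convex ℝ S)
    (hsign : ∀ p ∈ S, 0 ≤ p.1 ∧ p.2.1 ≤ 0)
    (hup : ∀ (ε ω ω' : ℝ) (l : Fin k → ℝ),
      (ε, ω, l) ∈ S → ω ≤ ω' → ω' ≤ 0 → (ε, ω', l) ∈ S)
    (hint : ∃ p ∈ S, 0 < p.1 ∧ p.2.1 < 0)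
    (ε₁ ω₁ : ℝ) (l₁ : Fin k → ℝ) (h₁ : (ε₁, ω₁, l₁) ∈ S)
    (ε₂ ω₂ : ℝ) (l₂ : Fin k → ℝ) (h₂ : (ε₂, ω₂, l₂) ∈ S)
    (hloc₁ : ∃ δ > 0, ∀ y ∈ S, ‖y - (ε₁, ω₁, l₁)‖ < δ →
      ε₁ * ω₁ ≤ y.1 * y.2.1)
    (hloc₂ : ∃ δ > 0, ∀ y ∈ S, ‖y - (ε₂, ω₂, l₂)‖ < δ →
      ε₂ * ω₂ ≤ y.1 * y.2.1) :
    ε₁ = ε₂ ∧ ω₁ = ω₂ := by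
  have A := aux_pos S hconv hsign hint _ h₁ hloc₁
  have B := aux_pos S hconv hsign hint _ h₂ hloc₂
  have C := (aux_dir S hconv _ _ h₁ h₂ hloc₁).1
  have D := (aux_dir S hconv _ _ h₂ h₁ hloc₂).1
  simp only at A B C D
  obtain ⟨a1, b1⟩ := A
  obtain ⟨a2, b2⟩ := B
  have P1 : 0 < -(ε₁ * ω₁) := by nlinarith
  have P2 : 0 < -(ε₂ * ω₂) := by nlinarith
  have hM : 0 ≤ -(ε₁ * ω₂ + ω₁ * ε₂) := by nlinarith
  have c1 : -(ε₁ * ω₂ + ω₁ * ε₂) ≤ 2 * -(ε₁ * ω₁) := by linarith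
  have c2 : -(ε₁ * ω₂ + ω₁ * ε₂) ≤ 2 * -(ε₂ * ω₂) := by linarith
  have hle := mul_le_mul c1 c2 hM (by linarith)
  have heq : ε₁ * ω₂ - ω₁ * ε₂ = 0 := by
    have : (ε₁ * ω₂ - ω₁ * ε₂) ^ 2 ≤ 0 := by nlinarith
    exact pow_eq_zero_iff (two_ne_zero) |>.1 (le_antisymm this (sq_nonneg _))
  have e1 : ω₁ ≤ ω₂ := by nlinarith
  have e2 : ω₂ ≤ ω₁ := by nlinarith
  have e : ω₁ = ω₂ := le_antisymm e1 e2
  refine ⟨?_, e⟩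
  subst e
  have : (ε₁ - ε₂) * ω₁ = 0 := by linarith
  rcases mul_eq_zero.1 this with h | h <;> linarith
end

section
/- Assume additionally: (iv) S is downward closed in ε: if (ε, ω, λ) ∈ S and 0 ≤ ε' ≤ ε then (ε', ω, λ) ∈ S. Suppose (ε*, ω*, λ*) ∈ S is a global minimum of g on S with ε* > 0 and ω* < 0. For ε ≥ 0 such that the slice {ω | ∃ λ, (ε, ω, λ) ∈ S} is nonempty and its infimum is attained, write ωᵒᵖᵗ(ε) for this minimum and f(ε) = ε * ωᵒᵖᵗ(ε). Then: (a) if 0 ≤ ε₁ < ε₂ ≤ ε* and ωᵒᵖᵗ is attained at both ε₁ and ε₂, then f(ε₁) > f(ε₂); (b) if ε* ≤ ε₁ < ε₂, ωᵒᵖᵗ is attained at both ε₁ and ε₂, and ωᵒᵖᵗ(ε₂) < 0, then f(ε₁) < f(ε₂). (The optimal objective value, as a function of ε, is strictly decreasing up to the optimum ε* and strictly increasing afterwards.) -/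
/-- The optimal objective value of the RepRSM synthesis bilinear program, as a function
of `ε`, is strictly decreasing up to the optimum `ε*` and strictly increasing after. -/
theorem stmt_11 {k : ℕ} (S : Set (ℝ × ℝ × (Fin k → ℝ))) (hconv : Convex ℝ S)
    (hsign : ∀ p ∈ S, 0 ≤ p.1 ∧ p.2.1 ≤ 0)
    (hup : ∀ (ε ω ω' : ℝ) (l : Fin k → ℝ),
      (ε, ω, l) ∈ S → ω ≤ ω' → ω' ≤ 0 → (ε, ω', l) ∈ S)
    (hint : ∃ p ∈ S, 0 < p.1 ∧ p.2.1 < 0)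
    (hdown : ∀ (ε ε' ω : ℝ) (l : Fin k → ℝ),
      (ε, ω, l) ∈ S → 0 ≤ ε' → ε' ≤ ε → (ε', ω, l) ∈ S)
    (εs ωs : ℝ) (ls : Fin k → ℝ) (hs : (εs, ωs, ls) ∈ S)
    (hglobal : ∀ p ∈ S, εs * ωs ≤ p.1 * p.2.1)
    (hεs : 0 < εs) (hωs : ωs < 0) :
    (∀ (ε₁ ε₂ ω₁ ω₂ : ℝ) (l₁ l₂ : Fin k → ℝ),
      0 ≤ ε₁ → ε₁ < ε₂ → ε₂ ≤ εs →
      (ε₁, ω₁, l₁) ∈ S → (∀ (ω' : ℝ) (l' : Fin k → ℝ), (ε₁, ω', l') ∈ S → ω₁ ≤ ω') →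
      (ε₂, ω₂, l₂) ∈ S → (∀ (ω' : ℝ) (l' : Fin k → ℝ), (ε₂, ω', l') ∈ S → ω₂ ≤ ω') →
      ε₂ * ω₂ < ε₁ * ω₁) ∧
    (∀ (ε₁ ε₂ ω₁ ω₂ : ℝ) (l₁ l₂ : Fin k → ℝ),
      εs ≤ ε₁ → ε₁ < ε₂ →
      (ε₁, ω₁, l₁) ∈ S → (∀ (ω' : ℝ) (l' : Fin k → ℝ), (ε₁, ω', l') ∈ S → ω₁ ≤ ω') →
      (ε₂, ω₂, l₂) ∈ S → (∀ (ω' : ℝ) (l' : Fin k → ℝ), (ε₂, ω', l') ∈ S → ω₂ ≤ ω') →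
      ω₂ < 0 →
      ε₁ * ω₁ < ε₂ * ω₂) := by
  have comb : ∀ (e w : ℝ) (l : Fin k → ℝ) (t : ℝ), (e, w, l) ∈ S → 0 ≤ t → t ≤ 1 →
      ((1 - t) * e + t * εs, (1 - t) * w + t * ωs, (1 - t) • l + t • ls) ∈ S := by
    intro e w l t h h0 h1
    have := hconv h hs (sub_nonneg.2 h1) h0 (by ring)
    simpa using this
  have key : ∀ (e w : ℝ) (l : Fin k → ℝ) (x wx : ℝ), (e, w, l) ∈ S → e ≠ εs →
      0 ≤ (e - εs) * (w - ωs) → (∀ (ω' : ℝ) (l' : Fin k → ℝ), (x, ω', l') ∈ S → wx ≤ ω') →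
      ∀ t : ℝ, 0 < t → t ≤ 1 → x = (1 - t) * e + t * εs → x * wx < e * w := by
    intro e w l x wx h hne hsg hx t h0 h1 hxt
    have hle : εs * ωs ≤ e * w := hglobal _ h
    have hlt : εs * ωs < e * w := by
      refine lt_of_le_of_ne hle fun heq => ?_
      have hm := hglobal _ (comb e w l (1/2) h (by norm_num) (by norm_num))
      simp only at hm
      have hz : (e - εs) * (w - ωs) = 0 := by nlinarith
      rcases mul_eq_zero.1 hz with h' | h'
      · exact hne (by linarith)
      · have : w = ωs := by linarith
        subst this
        exact hne (mul_right_cancel₀ hωs.ne heq).symm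
    have hc := comb e w l t h h0.le h1
    rw [← hxt] at hc
    have hw := hx _ _ hc
    have hx0 : 0 ≤ x := (hsign _ hc).1
    have h2 : x * wx ≤ x * ((1 - t) * w + t * ωs) := mul_le_mul_of_nonneg_left hw hx0
    have h3 : x * ((1 - t) * w + t * ωs) = (1 - t) * (e * w) + t * (εs * ωs)
        - t * (1 - t) * ((e - εs) * (w - ωs)) := by rw [hxt]; ring
    have h4 : 0 ≤ t * (1 - t) * ((e - εs) * (w - ωs)) :=
      mul_nonneg (mul_nonneg h0.le (sub_nonneg.2 h1)) hsg
    have h5 := mul_lt_mul_of_pos_left hlt h0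
    linarith
  constructor
  · intro ε₁ ε₂ ω₁ ω₂ l₁ l₂ h0 h12 h2 m1 o1 m2 o2
    have hlt : 0 < εs - ε₁ := by linarith
    have hw : ω₁ ≤ ωs := o1 _ _ (hdown _ _ _ _ hs h0 (by linarith))
    refine key ε₁ ω₁ l₁ ε₂ ω₂ m1 (by intro h; linarith) (by nlinarith) o2 ((ε₂ - ε₁) / (εs - ε₁))
      (div_pos (by linarith) hlt) ((div_le_one hlt).2 (by linarith)) ?_
    field_simp
    ring
  · intro ε₁ ε₂ ω₁ ω₂ l₁ l₂ h1 h12 m1 o1 m2 o2 _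
    have hlt : 0 < ε₂ - εs := by linarith
    have hw : ωs ≤ ω₂ := by
      have : εs * ωs ≤ εs * ω₂ := hglobal _ (hdown _ εs _ _ m2 hεs.le (by linarith))
      exact le_of_mul_le_mul_left this hεs
    refine key ε₂ ω₂ l₂ ε₁ ω₁ m2 (by intro h; linarith) (by nlinarith) o1 ((ε₂ - ε₁) / (ε₂ - εs))
      (div_pos (by linarith) hlt) ((div_le_one hlt).2 (by linarith)) ?_
    field_simp
    ring
end
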